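/- Let Y be an M×L complex matrix. Suppose A° is an M×K complex matrix with K < M, S° a K×L complex matrix with no zero row, P° = diag(p°_1, …, p°_K) with p°_k = ‖S°_k‖²/L where S°_k is the k-th row of S°, and σ° ∈ (0, 1] satisfies ‖Y − A° S°‖_F² = M L σ°. Let A* be an M×K complex matrix, P* = diag(p*_1, …, p*_K) with p*_k > 0, σ* > 0 and S* a K×L complex matrix such that ln det(A* P* A*^H + σ* I) + (1/L) tr(S*^H (P*)^{-1} S*) + (1/(L σ*)) ‖Y − A* S*‖_F² ≤ ln det(A° P° A°^H + σ° I) + (1/L) tr(S°^H (P°)^{-1} S°) + (1/(L σ°)) ‖Y − A° S°‖_F². Then ‖Y − A* S*‖_F² ≤ M L · e^{K/M} · Π_{k=1}^{K} (λ_k(A° P° A°^H) + 1)^{1/M} · (σ°)^{(M−K)/M}. (Quantitative fidelity bound (59)–(60) in the proof of Theorem 1, establishing A* S* → A° S° as σ° → 0.) -/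

import Mathlib

open Matrix

/-- The Frobenius norm of a complex matrix. -/
noncomputable def frob {m n : ℕ} (X : Matrix (Fin m) (Fin n) ℂ) : ℝ :=
  Real.sqrt (∑ i, ∑ j, ‖X i j‖ ^ 2)

lemma aux_det {M : ℕ} (B : Matrix (Fin M) (Fin M) ℂ) (hB : B.IsHermitian) (s : ℝ) :
    (B + (s : ℂ) • (1 : Matrix (Fin M) (Fin M) ℂ)).det.re = ∏ i, (hB.eigenvalues i + s) := by
  have h1 := Matrix.eval_charpoly B (-(s : ℂ))
  rw [hB.charpoly_eq, Polynomial.eval_prod] at h1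
  have h2 : Matrix.scalar (Fin M) (-(s : ℂ)) - B
      = -(B + (s : ℂ) • (1 : Matrix (Fin M) (Fin M) ℂ)) := by
    rw [Matrix.smul_one_eq_diagonal, Matrix.scalar_apply]
    ext i j
    by_cases h : i = j
    · subst h; simp; ring
    · simp [h]
  rw [h2, Matrix.det_neg] at h1
  have h3 : (∏ i, Polynomial.eval (-(s : ℂ)) (Polynomial.X - Polynomial.C ((hB.eigenvalues i : ℝ) : ℂ)))
      = (-1) ^ Fintype.card (Fin M) * ((∏ i, (hB.eigenvalues i + s) : ℝ) : ℂ) := by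
    push_cast
    rw [← Finset.card_univ, ← Finset.prod_const, ← Finset.prod_mul_distrib]
    refine Finset.prod_congr rfl fun i _ => ?_
    simp; ring
  have h4 := h3.symm.trans h1
  have h5 := mul_left_cancel₀ (pow_ne_zero _ (by norm_num : (-1 : ℂ) ≠ 0)) h4
  rw [← h5, Complex.ofReal_re]

open scoped ComplexOrder in
lemma aux_psd {M K : ℕ} (A : Matrix (Fin M) (Fin K) ℂ) (p : Fin K → ℝ) (hp : ∀ k, 0 ≤ p k) :
    (A * Matrix.diagonal (fun k => (p k : ℂ)) * Aᴴ).PosSemidef := by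
  apply Matrix.PosSemidef.mul_mul_conjTranspose_same
  apply Matrix.PosSemidef.diagonal
  intro k
  simpa using hp k

lemma aux_herm {M K : ℕ} (A : Matrix (Fin M) (Fin K) ℂ) (p : Fin K → ℝ) (hp : ∀ k, 0 ≤ p k) :
    (A * Matrix.diagonal (fun k => (p k : ℂ)) * Aᴴ).IsHermitian := (aux_psd A p hp).1

lemma aux_nonneg {M K : ℕ} (A : Matrix (Fin M) (Fin K) ℂ) (p : Fin K → ℝ) (hp : ∀ k, 0 ≤ p k)
    (hB : (A * Matrix.diagonal (fun k => (p k : ℂ)) * Aᴴ).IsHermitian) (i : Fin M) :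
    0 ≤ hB.eigenvalues i := (aux_psd A p hp).eigenvalues_nonneg i

lemma aux_trace {K L : ℕ} (S : Matrix (Fin K) (Fin L) ℂ) (p : Fin K → ℝ) :
    (Sᴴ * Matrix.diagonal (fun k => ((p k)⁻¹ : ℂ)) * S).trace.re
      = ∑ k, (p k)⁻¹ * ∑ l, ‖S k l‖ ^ 2 := by
  have : (Sᴴ * Matrix.diagonal (fun k => ((p k)⁻¹ : ℂ)) * S).trace
      = ((∑ k, (p k)⁻¹ * ∑ l, ‖S k l‖ ^ 2 : ℝ) : ℂ) := by
    simp only [Matrix.trace, Matrix.diag_apply]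
    have hh : ∀ l, (Sᴴ * Matrix.diagonal (fun k => ((p k)⁻¹ : ℂ)) * S) l l
        = ∑ k, star (S k l) * ((p k)⁻¹ : ℂ) * S k l := by
      intro l
      rw [Matrix.mul_apply]
      simp only [Matrix.mul_diagonal, Matrix.conjTranspose_apply]
    simp only [hh]
    rw [Finset.sum_comm]
    push_cast
    refine Finset.sum_congr rfl fun k _ => ?_
    rw [Finset.mul_sum]
    refine Finset.sum_congr rfl fun l _ => ?_
    rw [← Complex.conj_mul']
    simp; ring
  rw [this, Complex.ofReal_re]

lemma aux_zero {M K : ℕ} (lam : Fin M → ℝ) (hmono : Antitone lam) (h0 : ∀ i, 0 ≤ lam i)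
    (hc : Fintype.card {i // lam i ≠ 0} ≤ K) (i : Fin M) (hi : K ≤ i) : lam i = 0 := by
  by_contra hne
  have hpos : 0 < lam i := lt_of_le_of_ne (h0 i) (Ne.symm hne)
  have : (Finset.Iic i).card ≤ K := by
    refine le_trans ?_ hc
    rw [Fintype.card_subtype]
    apply Finset.card_le_card
    intro j hj
    simp only [Finset.mem_Iic] at hj
    simp only [Finset.mem_filter, Finset.mem_univ, true_and]
    exact (lt_of_lt_of_le hpos (hmono hj)).ne'
  rw [Fin.card_Iic] at this
  omega

lemma aux_prod {M K : ℕ} (hK : K ≤ M) (lam : Fin M → ℝ) (h0 : ∀ i, 0 ≤ lam i)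
    (hz : ∀ i : Fin M, K ≤ i → lam i = 0) (s : ℝ) (hs : 0 < s) (hs1 : s ≤ 1) :
    ∏ i, (lam i + s) ≤ (∏ k : Fin K, (lam (Fin.castLE hK k) + 1)) * s ^ (M - K) := by
  obtain ⟨d, rfl⟩ := Nat.exists_eq_add_of_le hK
  rw [Fin.prod_univ_add]
  have h2 : ∏ i : Fin d, (lam (Fin.natAdd K i) + s) = s ^ (K + d - K) := by
    rw [Finset.prod_congr rfl (fun i _ => by rw [hz (Fin.natAdd K i) (by simp), zero_add])]
    simp
  rw [h2]
  refine mul_le_mul_of_nonneg_right ?_ (by positivity)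
  refine Finset.prod_le_prod (fun i _ => add_nonneg (h0 _) hs.le) fun i _ => ?_
  exact add_le_add le_rfl hs1

/-- bound (59)–(60) in the proof of Theorem 1: under the stated ground-truth and
near-optimality assumptions,
`‖Y - A* S*‖_F² ≤ M L e^{K/M} ∏_{k=1}^{K} (λ_k(A°P°A°ᴴ) + 1)^{1/M} (σ°)^{(M-K)/M}`,
where `lam` lists the eigenvalues of `A° P° A°ᴴ` in decreasing order. -/
theorem stmt12 {M K L : ℕ} (hK : K < M) (hL : 1 ≤ L)
    (Y : Matrix (Fin M) (Fin L) ℂ)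
    (Ao : Matrix (Fin M) (Fin K) ℂ) (So : Matrix (Fin K) (Fin L) ℂ)
    (hSo : ∀ k, ∃ l, So k l ≠ 0)
    (po : Fin K → ℝ) (hpo : ∀ k, po k = (∑ l, ‖So k l‖ ^ 2) / (L : ℝ))
    (σo : ℝ) (hσo0 : 0 < σo) (hσo1 : σo ≤ 1)
    (hfid : (frob (Y - Ao * So)) ^ 2 = (M : ℝ) * (L : ℝ) * σo)
    (As : Matrix (Fin M) (Fin K) ℂ) (ps : Fin K → ℝ) (hps : ∀ k, 0 < ps k)
    (σs : ℝ) (hσs : 0 < σs) (Ss : Matrix (Fin K) (Fin L) ℂ)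
    (hBo : (Ao * Matrix.diagonal (fun k => (po k : ℂ)) * Aoᴴ).IsHermitian)
    (lam : Fin M → ℝ) (hmono : Antitone lam)
    (e : Fin M ≃ Fin M) (hlam : lam = hBo.eigenvalues ∘ e)
    (hineq :
      Real.log (As * Matrix.diagonal (fun k => (ps k : ℂ)) * Asᴴ + (σs : ℂ) • (1 : Matrix (Fin M) (Fin M) ℂ)).det.re
          + (1 / (L : ℝ)) * (Ssᴴ * Matrix.diagonal (fun k => ((ps k)⁻¹ : ℂ)) * Ss).trace.re
          + (1 / ((L : ℝ) * σs)) * (frob (Y - As * Ss)) ^ 2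
        ≤ Real.log (Ao * Matrix.diagonal (fun k => (po k : ℂ)) * Aoᴴ + (σo : ℂ) • (1 : Matrix (Fin M) (Fin M) ℂ)).det.re
          + (1 / (L : ℝ)) * (Soᴴ * Matrix.diagonal (fun k => ((po k)⁻¹ : ℂ)) * So).trace.re
          + (1 / ((L : ℝ) * σo)) * (frob (Y - Ao * So)) ^ 2) :
    (frob (Y - As * Ss)) ^ 2
      ≤ (M : ℝ) * (L : ℝ) * Real.exp ((K : ℝ) / (M : ℝ))
        * (∏ k : Fin K, (lam (Fin.castLE hK.le k) + 1) ^ ((1 : ℝ) / (M : ℝ)))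
        * σo ^ (((M : ℝ) - (K : ℝ)) / (M : ℝ)) := by
  have hM : (0 : ℝ) < M := by exact_mod_cast (by omega : 0 < M)
  have hLp : (0 : ℝ) < L := by exact_mod_cast hL
  have hSpos : ∀ k, 0 < ∑ l, ‖So k l‖ ^ 2 := by
    intro k
    obtain ⟨l, hl⟩ := hSo k
    exact Finset.sum_pos' (fun _ _ => by positivity) ⟨l, Finset.mem_univ _, by positivity⟩
  have hpop : ∀ k, 0 < po k := fun k => by rw [hpo k]; exact div_pos (hSpos k) hLp
  have hpsd := aux_nonneg Ao po (fun k => (hpop k).le)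
  have hlam0 : ∀ i, 0 ≤ lam i := fun i => by rw [hlam]; exact hpsd hBo _
  have hcard : Fintype.card {i // lam i ≠ 0} ≤ K := by
    have h1 := hBo.rank_eq_card_non_zero_eigs
    have h2 : Fintype.card {i // lam i ≠ 0} = Fintype.card {i // hBo.eigenvalues i ≠ 0} :=
      Fintype.card_congr (e.subtypeEquiv (fun i => by rw [hlam]; rfl))
    rw [h2, ← h1, Matrix.mul_assoc]
    refine (Matrix.rank_mul_le_left _ _).trans ?_
    simpa using Matrix.rank_le_width Ao
  have hz := aux_zero lam hmono hlam0 hcard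
  have hdeto : (Ao * Matrix.diagonal (fun k => (po k : ℂ)) * Aoᴴ
      + (σo : ℂ) • (1 : Matrix (Fin M) (Fin M) ℂ)).det.re = ∏ i, (lam i + σo) := by
    rw [aux_det _ hBo, hlam]
    exact (Equiv.prod_comp e (fun i => hBo.eigenvalues i + σo)).symm
  set Q := ∏ k : Fin K, (lam (Fin.castLE hK.le k) + 1) with hQ
  have hQpos : 0 < Q := Finset.prod_pos fun k _ => by linarith [hlam0 (Fin.castLE hK.le k)]
  have hlogo : Real.log (∏ i, (lam i + σo)) ≤ Real.log Q + ((M : ℝ) - K) * Real.log σo := by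
    have h := aux_prod hK.le lam hlam0 hz σo hσo0 hσo1
    have h' := Real.log_le_log (Finset.prod_pos fun i _ => by linarith [hlam0 i]) h
    rwa [Real.log_mul hQpos.ne' (by positivity), Real.log_pow, Nat.cast_sub hK.le] at h'
  have hso : (1 / (L : ℝ)) * (Soᴴ * Matrix.diagonal (fun k => ((po k)⁻¹ : ℂ)) * So).trace.re = K := by
    rw [aux_trace]
    have : ∀ k, (po k)⁻¹ * ∑ l, ‖So k l‖ ^ 2 = L := by
      intro k
      have := (hSpos k).ne'
      rw [hpo k]
      field_simp
    simp only [this]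
    simp
    field_simp
  have hthird : (1 / ((L : ℝ) * σo)) * (frob (Y - Ao * So)) ^ 2 = M := by
    rw [hfid]; field_simp
  have hpsds := aux_herm As ps (fun k => (hps k).le)
  have hpsn := aux_nonneg As ps (fun k => (hps k).le) hpsds
  have hlogs : (M : ℝ) * Real.log σs ≤ Real.log (As * Matrix.diagonal (fun k => (ps k : ℂ)) * Asᴴ
      + (σs : ℂ) • (1 : Matrix (Fin M) (Fin M) ℂ)).det.re := by
    rw [aux_det _ hpsds, ← Real.log_pow]
    apply Real.log_le_log (by positivity)
    have := Finset.prod_le_prod (s := Finset.univ) (f := fun _ : Fin M => σs)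
      (g := fun i => hpsds.eigenvalues i + σs) (fun _ _ => hσs.le)
      (fun i _ => by linarith [hpsn i])
    simpa using this
  have hss : 0 ≤ (1 / (L : ℝ)) * (Ssᴴ * Matrix.diagonal (fun k => ((ps k)⁻¹ : ℂ)) * Ss).trace.re := by
    rw [aux_trace]
    refine mul_nonneg (by positivity) (Finset.sum_nonneg fun k _ => ?_)
    have := hps k
    positivity
  rw [hdeto, hso, hthird] at hineq
  rw [Real.finsetProd_rpow _ _ (fun k _ => by linarith [hlam0 (Fin.castLE hK.le k)]), ← hQ]
  rcases eq_or_lt_of_le (sq_nonneg (frob (Y - As * Ss))) with hF | hF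
  · rw [← hF]; positivity
  set F := (frob (Y - As * Ss)) ^ 2
  have hx := Real.log_le_sub_one_of_pos (x := F / (L * M * σs)) (by positivity)
  have hlogx : Real.log (F / (L * M * σs)) = Real.log (F / (M * L)) - Real.log σs := by
    rw [← Real.log_div (by positivity) (by positivity)]
    congr 1; field_simp
  have hFe : (1 / ((L : ℝ) * σs)) * F = M * (F / (L * M * σs)) := by field_simp
  have hmain : M * Real.log (F / (M * L)) ≤ Real.log Q + ((M : ℝ) - K) * Real.log σo + K := by
    have := mul_le_mul_of_nonneg_left hx hM.le
    rw [hlogx] at this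
    rw [hFe] at hineq
    linarith
  have hfin : Real.log (F / (M * L)) ≤
      Real.log (Real.exp ((K : ℝ) / M) * Q ^ ((1 : ℝ) / M) * σo ^ (((M : ℝ) - K) / M)) := by
    rw [Real.log_mul (by positivity) (by positivity), Real.log_mul (by positivity) (by positivity),
      Real.log_exp, Real.log_rpow hQpos, Real.log_rpow hσo0]
    rw [← mul_le_mul_iff_right₀ hM]
    refine hmain.trans (le_of_eq ?_)
    field_simp
    ring
  have := (Real.log_le_log_iff (by positivity) (by positivity)).1 hfin
  rw [div_le_iff₀ (by positivity)] at this
  linarith
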